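/- Let R(q) = (q,q^4;q^5)_∞/(q^2,q^3;q^5)_∞. Then (1/(R(q) R(q^4)) + q^2 R(q) R(q^4)) - (R(q)/(R(q^2) R(q^4)) - q^2 R(q^2) R(q^4)/R(q)) = 2q. -/

import Mathlib

/-- Euler's product E(q) = ∏_{k≥0} (1 - q^{k+1}). -/
noncomputable def E (q : ℂ) : ℂ := ∏' k : ℕ, (1 - q ^ (k + 1))

/-- q-Pochhammer infinite product (a;q)_∞ = ∏_{k≥0} (1 - a q^k). -/
noncomputable def qp (a q : ℂ) : ℂ := ∏' k : ℕ, (1 - a * q ^ k)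

/-- Rogers–Ramanujan function G(q) = 1/((q,q^4;q^5)_∞). -/
noncomputable def G (q : ℂ) : ℂ := 1 / (qp q (q ^ 5) * qp (q ^ 4) (q ^ 5))

/-- Rogers–Ramanujan function H(q) = 1/((q^2,q^3;q^5)_∞). -/
noncomputable def H (q : ℂ) : ℂ := 1 / (qp (q ^ 2) (q ^ 5) * qp (q ^ 3) (q ^ 5))

/-- Rogers–Ramanujan continued fraction product R(q). -/
noncomputable def R (q : ℂ) : ℂ :=
  (qp q (q ^ 5) * qp (q ^ 4) (q ^ 5)) / (qp (q ^ 2) (q ^ 5) * qp (q ^ 3) (q ^ 5))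

open Filter Topology

/-- The general term `p^(n(n-1)/2) z^n` of the two-sided theta series. -/
noncomputable def thetaTerm (p z : ℂ) (n : ℤ) : ℂ := p ^ (n * (n - 1) / 2) * z ^ n

/-- The theta series `∑ p^(n(n-1)/2) z^n` over all integers. -/
noncomputable def thetaSeries (p z : ℂ) : ℂ := ∑' n : ℤ, thetaTerm p z n

lemma thetaTerm_ne_zero {p z : ℂ} (hp : p ≠ 0) (hz : z ≠ 0) (n : ℤ) : thetaTerm p z n ≠ 0 :=
  mul_ne_zero (zpow_ne_zero _ hp) (zpow_ne_zero _ hz)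

lemma thetaTerm_add_one {p z : ℂ} (hp : p ≠ 0) (hz : z ≠ 0) (n : ℤ) :
    thetaTerm p z (n + 1) = thetaTerm p z n * (p ^ n * z) := by
  have h : (n + 1) * (n + 1 - 1) / 2 = n * (n - 1) / 2 + n := by
    rw [← Int.add_mul_ediv_right _ _ two_ne_zero]
    congr 1
    ring
  rw [thetaTerm, thetaTerm, h, zpow_add₀ hp, zpow_add_one₀ hz]
  ring

lemma summable_thetaTerm {p z : ℂ} (hp : p ≠ 0) (hp1 : ‖p‖ < 1) (hz : z ≠ 0) :
    Summable fun n ↦ ‖thetaTerm p z n‖ := by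
  have hlim : Tendsto (fun n : ℕ ↦ ‖p‖ ^ n) atTop (𝓝 0) :=
    tendsto_pow_atTop_nhds_zero_of_lt_one (norm_nonneg _) hp1
  refine Summable.norm (Summable.of_nat_of_neg_add_one ?_ ?_)
  · refine summable_of_ratio_test_tendsto_lt_one zero_lt_one
      (Eventually.of_forall fun n ↦ thetaTerm_ne_zero hp hz _) ?_
    have h := hlim.mul_const ‖z‖
    rw [zero_mul] at h
    refine h.congr fun n ↦ ?_
    push_cast
    rw [thetaTerm_add_one hp hz, norm_mul,
      mul_div_cancel_left₀ _ (norm_ne_zero_iff.2 (thetaTerm_ne_zero hp hz _))]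
    simp
  · refine summable_of_ratio_test_tendsto_lt_one zero_lt_one
      (Eventually.of_forall fun n ↦ thetaTerm_ne_zero hp hz _) ?_
    have h := ((tendsto_add_atTop_iff_nat 2).2 hlim).mul_const ‖z‖⁻¹
    rw [zero_mul] at h
    refine h.congr fun n ↦ ?_
    have hstep := thetaTerm_add_one hp hz (-((n : ℤ) + 1 + 1))
    have hne := thetaTerm_ne_zero hp hz (-((n : ℤ) + 1 + 1))
    rw [show -((n : ℤ) + 1 + 1) + 1 = -((n : ℤ) + 1) by ring] at hstep
    push_cast
    rw [hstep, ← norm_div, show -((n : ℤ) + 1 + 1) = -((n + 2 : ℕ) : ℤ) by push_cast; ring,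
      zpow_neg, zpow_natCast, ← norm_pow, ← norm_inv, ← norm_mul]
    rw [show -((n : ℤ) + 1 + 1) = -((n + 2 : ℕ) : ℤ) by push_cast; ring] at hne
    congr 1
    have := pow_ne_zero (n + 2) hp
    field_simp

/-- The pairs `(m, n)` of integers, parametrised by half sum and half difference according to
the parity of `m + n`. -/
noncomputable def sumDiffEquiv : (ℤ × ℤ) ⊕ (ℤ × ℤ) ≃ ℤ × ℤ :=
  Equiv.ofBijective
    (Sum.elim (fun x ↦ (x.1 + x.2, x.1 - x.2)) (fun x ↦ (x.1 + x.2 + 1, x.1 - x.2))) <| by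
    constructor
    · rintro (⟨a, b⟩ | ⟨a, b⟩) (⟨c, d⟩ | ⟨c, d⟩) h <;>
        simp only [Sum.elim_inl, Sum.elim_inr, Prod.mk.injEq, Sum.inl.injEq, Sum.inr.injEq,
          reduceCtorEq] at h ⊢ <;> omega
    · rintro ⟨m, n⟩
      rcases Int.even_or_odd' (m + n) with ⟨k, hk | hk⟩
      · exact ⟨Sum.inl (k, m - k), by simp; omega⟩
      · exact ⟨Sum.inr (k, m - k - 1), by simp; omega⟩

lemma thetaTerm_mul_even {p x y : ℂ} (hp : p ≠ 0) (hx : x ≠ 0) (hy : y ≠ 0) (r s : ℤ) :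
    thetaTerm p x (r + s) * thetaTerm p y (r - s) =
      thetaTerm (p ^ 2) (x * y) r * thetaTerm (p ^ 2) (p * x / y) s := by
  have tri (n : ℤ) : n * (n - 1) / 2 * 2 = n * (n - 1) :=
    Int.ediv_mul_cancel (Int.even_mul_pred_self n).two_dvd
  have h : (r + s) * (r + s - 1) / 2 + (r - s) * (r - s - 1) / 2 =
      r * (r - 1) / 2 * 2 + s * (s - 1) / 2 * 2 + s := by
    rw [tri, tri]
    linarith [tri (r + s), tri (r - s)]
  have hpow : p ^ ((r + s) * (r + s - 1) / 2) * p ^ ((r - s) * (r - s - 1) / 2) =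
      (p ^ 2) ^ (r * (r - 1) / 2) * (p ^ 2) ^ (s * (s - 1) / 2) * p ^ s := by
    rw [← zpow_add₀ hp, h, zpow_add₀ hp, zpow_add₀ hp, mul_comm _ (2 : ℤ), mul_comm _ (2 : ℤ),
      zpow_mul, zpow_mul]
    norm_cast
  simp only [thetaTerm]
  rw [mul_mul_mul_comm, hpow, zpow_add₀ hx, zpow_sub₀ hy, mul_zpow, div_zpow, mul_zpow]
  field_simp

lemma thetaTerm_mul_odd {p x y : ℂ} (hp : p ≠ 0) (hx : x ≠ 0) (hy : y ≠ 0) (r s : ℤ) :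
    thetaTerm p x (r + s + 1) * thetaTerm p y (r - s) =
      x * (thetaTerm (p ^ 2) (p * x * y) r * thetaTerm (p ^ 2) (p ^ 2 * x / y) s) := by
  have hmul (a b : ℂ) (n : ℤ) : thetaTerm (p ^ 2) (a * b) n = a ^ n * thetaTerm (p ^ 2) b n := by
    simp only [thetaTerm, mul_zpow]
    ring
  rw [thetaTerm_add_one hp hx, mul_right_comm, thetaTerm_mul_even hp hx hy,
    show p ^ 2 * x / y = p * (p * x / y) by ring, hmul p, mul_assoc p x y, hmul p (x * y),
    zpow_add₀ hp]
  ring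

theorem thetaSeries_mul {p x y : ℂ} (hp : p ≠ 0) (hp1 : ‖p‖ < 1) (hx : x ≠ 0) (hy : y ≠ 0) :
    thetaSeries p x * thetaSeries p y =
      thetaSeries (p ^ 2) (x * y) * thetaSeries (p ^ 2) (p * x / y) +
        x * (thetaSeries (p ^ 2) (p * x * y) * thetaSeries (p ^ 2) (p ^ 2 * x / y)) := by
  have hp2 : p ^ 2 ≠ 0 := pow_ne_zero _ hp
  have hp21 : ‖p ^ 2‖ < 1 := by
    rw [norm_pow]
    exact pow_lt_one₀ (norm_nonneg _) hp1 two_ne_zero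
  have key {a b c : ℂ} (hc : c ≠ 0) (ha : a ≠ 0) (hb : b ≠ 0) (hc1 : ‖c‖ < 1) :
      HasSum (fun i : ℤ × ℤ ↦ thetaTerm c a i.1 * thetaTerm c b i.2)
        (thetaSeries c a * thetaSeries c b) := by
    have h1 := summable_thetaTerm hc hc1 ha
    have h2 := summable_thetaTerm hc hc1 hb
    rw [thetaSeries, thetaSeries, tsum_mul_tsum_of_summable_norm h1 h2]
    exact (summable_mul_of_summable_norm h1 h2).hasSum
  refine ((sumDiffEquiv.hasSum_iff.2 (key hp hx hy hp1)).unique (HasSum.sum ?_ ?_))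
  · convert! (key hp2 (mul_ne_zero hx hy) (div_ne_zero (mul_ne_zero hp hx) hy) hp21) using 1
    ext ⟨r, s⟩
    exact (thetaTerm_mul_even hp hx hy r s)
  · convert! (key hp2 (mul_ne_zero (mul_ne_zero hp hx) hy)
      (div_ne_zero (mul_ne_zero hp2 hx) hy) hp21).mul_left x using 1
    ext ⟨r, s⟩
    exact thetaTerm_mul_odd hp hx hy r s

/-- The inverse of the finite product `∏ (1 - p^(i+1))` over `i < n`, extended by zero to
negative integers. -/
noncomputable def eulerInv (p : ℂ) : ℤ → ℂ
  | .ofNat n => (∏ i ∈ Finset.range n, (1 - p ^ (i + 1)))⁻¹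
  | .negSucc _ => 0

lemma eulerInv_natCast (p : ℂ) (n : ℕ) :
    eulerInv p n = (∏ i ∈ Finset.range n, (1 - p ^ (i + 1)))⁻¹ := rfl

lemma eulerInv_of_neg (p : ℂ) {m : ℤ} (hm : m < 0) : eulerInv p m = 0 := by
  obtain ⟨k, rfl⟩ := Int.eq_negSucc_of_lt_zero hm
  rfl

lemma one_sub_pow_ne_zero {p : ℂ} (hp1 : ‖p‖ < 1) {n : ℕ} (hn : n ≠ 0) : 1 - p ^ n ≠ 0 := by
  intro h
  have := pow_lt_one₀ (norm_nonneg p) hp1 hn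
  rw [← norm_pow, ← sub_eq_zero.1 h, norm_one] at this
  exact lt_irrefl _ this

lemma eulerInv_sub_one {p : ℂ} (hp1 : ‖p‖ < 1) (m : ℤ) :
    eulerInv p (m - 1) = (1 - p ^ m) * eulerInv p m := by
  rcases lt_trichotomy m 0 with hm | rfl | hm
  · rw [eulerInv_of_neg p hm, eulerInv_of_neg p (by omega), mul_zero]
  · rw [eulerInv_of_neg p (by omega), zpow_zero, sub_self, zero_mul]
  · obtain ⟨n, rfl⟩ : ∃ n : ℕ, m = (n + 1 : ℕ) := ⟨(m - 1).toNat, by omega⟩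
    have h0 := one_sub_pow_ne_zero hp1 n.succ_ne_zero
    rw [show ((n + 1 : ℕ) : ℤ) - 1 = n by push_cast; ring, eulerInv_natCast, eulerInv_natCast,
      zpow_natCast, Finset.prod_range_succ, mul_inv, mul_left_comm, mul_inv_cancel₀ h0, mul_one]

/-- Coefficients of the finite form of the Jacobi triple product. -/
noncomputable def tripleCoeff (p : ℂ) (n : ℕ) (j : ℤ) : ℂ :=
  (∏ i ∈ Finset.range (2 * n), (1 - p ^ (i + 1))) * eulerInv p (n + j) * eulerInv p (n - j)

lemma tripleCoeff_succ {p : ℂ} (hp : p ≠ 0) (hp1 : ‖p‖ < 1) (n : ℕ) (j : ℤ) :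
    tripleCoeff p (n + 1) j = (1 + p ^ (2 * n + 1)) * tripleCoeff p n j +
      p ^ ((n : ℤ) + 1 - j) * tripleCoeff p n (j - 1) +
      p ^ ((n : ℤ) + 1 + j) * tripleCoeff p n (j + 1) := by
  have a1 : eulerInv p (n + j) = _ := (congrArg _ (by ring)).trans (eulerInv_sub_one hp1 (n + 1 + j))
  have a2 : eulerInv p (n - j) = _ := (congrArg _ (by ring)).trans (eulerInv_sub_one hp1 (n + 1 - j))
  have a3 : eulerInv p (n + (j - 1)) = _ :=
    (congrArg _ (by ring)).trans (eulerInv_sub_one hp1 (n + j))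
  have a4 : eulerInv p (n - (j + 1)) = _ :=
    (congrArg _ (by ring)).trans (eulerInv_sub_one hp1 (n - j))
  have b1 : (n : ℤ) - (j - 1) = n + 1 - j := by ring
  have b2 : (n : ℤ) + (j + 1) = n + 1 + j := by ring
  have c1 : p ^ ((n : ℤ) + j) = p ^ ((n : ℤ) + 1 + j) / p := by
    rw [div_eq_mul_inv, ← zpow_sub_one₀ hp]; congr 1; ring
  have c2 : p ^ ((n : ℤ) - j) = p ^ ((n : ℤ) + 1 - j) / p := by
    rw [div_eq_mul_inv, ← zpow_sub_one₀ hp]; congr 1; ring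
  have hXY : p ^ ((n : ℤ) + 1 + j) * p ^ ((n : ℤ) + 1 - j) = p ^ (2 * n + 2) := by
    rw [← zpow_add₀ hp, ← zpow_natCast]; congr 1; push_cast; ring
  simp only [tripleCoeff, b1, b2, show 2 * (n + 1) = 2 * n + 1 + 1 by ring,
    Finset.prod_range_succ, Nat.cast_add, Nat.cast_one]
  rw [a3, a4, a1, a2, c1, c2]
  have hZ : p ^ (2 * n + 1) = p ^ ((n : ℤ) + 1 + j) * p ^ ((n : ℤ) + 1 - j) / p := by
    rw [hXY, pow_succ _ (2 * n + 1)]; field_simp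
  rw [show 2 * n + 1 + 1 = 2 * n + 2 by ring, ← hXY, hZ]
  field_simp
  ring

lemma hasSum_tripleCoeff {p z : ℂ} (hp : p ≠ 0) (hp1 : ‖p‖ < 1) (hz : z ≠ 0) (n : ℕ) :
    HasSum (fun j ↦ tripleCoeff p n j * thetaTerm p z j)
      ((∏ i ∈ Finset.range n, (1 + z * p ^ i)) * ∏ i ∈ Finset.range n, (1 + p / z * p ^ i)) := by
  induction n with
  | zero =>
    have h := hasSum_single (f := fun j ↦ tripleCoeff p 0 j * thetaTerm p z j) 0 (by
      intro j hj
      rcases hj.lt_or_gt with hj | hj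
      · simp [tripleCoeff, eulerInv_of_neg p hj]
      · simp [tripleCoeff, eulerInv_of_neg p (neg_neg_of_pos hj)])
    have h0 : eulerInv p 0 = 1 := by simpa using eulerInv_natCast p 0
    simpa [tripleCoeff, thetaTerm, h0] using h
  | succ n ih =>
    have h1 := ih.mul_left (1 + p ^ (2 * n + 1))
    have h2 := ((Equiv.subRight (1 : ℤ)).hasSum_iff.2 ih).mul_left (z * p ^ n)
    have h3 := ((Equiv.addRight (1 : ℤ)).hasSum_iff.2 ih).mul_left (p ^ (n + 1) / z)
    convert! (h1.add h2).add h3 using 1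
    · ext (j : ℤ)
      have t1 := thetaTerm_add_one hp hz (j - 1 : ℤ)
      rw [sub_add_cancel] at t1
      simp only [Function.comp_apply, Equiv.subRight_apply, Equiv.coe_addRight,
        tripleCoeff_succ hp hp1, thetaTerm_add_one hp hz j]
      rw [t1, zpow_sub_one₀ hp, zpow_add₀ hp _ j, zpow_sub₀ hp _ j, zpow_add₀ hp, zpow_one,
        zpow_natCast]
      have := zpow_ne_zero j hp
      field_simp
      ring
    · rw [Finset.prod_range_succ, Finset.prod_range_succ]
      field_simp
      ring

lemma summable_qp (a : ℂ) {p : ℂ} (hp1 : ‖p‖ < 1) : Summable fun k : ℕ ↦ ‖-(a * p ^ k)‖ := by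
  simpa using (summable_geometric_of_lt_one (norm_nonneg p) hp1).mul_left ‖a‖

lemma multipliable_qp (a : ℂ) {p : ℂ} (hp1 : ‖p‖ < 1) :
    Multipliable fun k : ℕ ↦ 1 - a * p ^ k := by
  simpa only [sub_eq_add_neg] using multipliable_one_add_of_summable (summable_qp a hp1)

lemma tendsto_qp (a : ℂ) {p : ℂ} (hp1 : ‖p‖ < 1) :
    Tendsto (fun n ↦ ∏ i ∈ Finset.range n, (1 - a * p ^ i)) atTop (𝓝 (qp a p)) :=
  (multipliable_qp a hp1).tendsto_prod_tprod_nat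

lemma qp_ne_zero {a p : ℂ} (ha : ‖a‖ < 1) (hp1 : ‖p‖ < 1) : qp a p ≠ 0 := by
  have h := tprod_one_add_ne_zero_of_summable (f := fun k : ℕ ↦ -(a * p ^ k)) ?_ (summable_qp a hp1)
  · simpa only [qp, sub_eq_add_neg] using h
  · intro k hk
    have h1 : a * p ^ k = 1 := by linear_combination -hk
    have h2 : ‖a * p ^ k‖ < 1 := by
      rw [norm_mul, norm_pow]
      exact mul_lt_one_of_nonneg_of_lt_one_left (norm_nonneg _) ha
        (pow_le_one₀ (norm_nonneg _) hp1.le)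
    rw [h1, norm_one] at h2
    exact lt_irrefl _ h2

lemma qp_mul_qp_neg (a : ℂ) {p : ℂ} (hp1 : ‖p‖ < 1) :
    qp a p * qp (-a) p = qp (a ^ 2) (p ^ 2) := by
  rw [qp, qp, ← (multipliable_qp a hp1).tprod_mul (multipliable_qp (-a) hp1)]
  exact tprod_congr fun k ↦ by ring

lemma qp_eq_mul_qp_sq (a : ℂ) {p : ℂ} (hp1 : ‖p‖ < 1) :
    qp a p = qp a (p ^ 2) * qp (a * p) (p ^ 2) := by
  have hp2 : ‖p ^ 2‖ < 1 := by
    rw [norm_pow]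
    exact pow_lt_one₀ (norm_nonneg _) hp1 two_ne_zero
  have he (k : ℕ) : 1 - a * (p ^ 2) ^ k = 1 - a * p ^ (2 * k) := by ring
  have ho (k : ℕ) : 1 - a * p * (p ^ 2) ^ k = 1 - a * p ^ (2 * k + 1) := by ring
  have h1 := multipliable_qp a hp2
  have h2 := multipliable_qp (a * p) hp2
  simp only [he] at h1
  simp only [ho] at h2
  simp only [qp, he, ho]
  exact (tprod_even_mul_odd (f := fun k ↦ 1 - a * p ^ k) h1 h2).symm

lemma tendsto_eulerInv {p : ℂ} (hp1 : ‖p‖ < 1) :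
    Tendsto (fun n : ℕ ↦ eulerInv p n) atTop (𝓝 (qp p p)⁻¹) := by
  refine ((tendsto_qp p hp1).inv₀ (qp_ne_zero hp1 hp1)).congr fun n ↦ ?_
  rw [eulerInv_natCast]
  simp only [pow_succ']

lemma exists_norm_eulerInv_le {p : ℂ} (hp1 : ‖p‖ < 1) : ∃ C, ∀ m, ‖eulerInv p m‖ ≤ C := by
  obtain ⟨C, hC⟩ := (Metric.isBounded_range_of_tendsto _ (tendsto_eulerInv hp1)).exists_norm_le
  refine ⟨C, fun m ↦ ?_⟩
  rcases lt_or_ge m 0 with hm | hm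
  · rw [eulerInv_of_neg p hm, norm_zero]
    exact (norm_nonneg _).trans (hC _ ⟨0, rfl⟩)
  · exact hC _ ⟨m.toNat, by simp only [Int.toNat_of_nonneg hm]⟩

lemma tendsto_eulerInv_int {p : ℂ} (hp1 : ‖p‖ < 1) :
    Tendsto (eulerInv p) atTop (𝓝 (qp p p)⁻¹) := by
  have h : Tendsto Int.toNat atTop atTop :=
    tendsto_atTop.2 fun n ↦ (eventually_ge_atTop (n : ℤ)).mono fun m hm ↦ by omega
  refine ((tendsto_eulerInv hp1).comp h).congr' ?_
  filter_upwards [eventually_ge_atTop 0] with m hm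
  simp only [Function.comp_apply, Int.toNat_of_nonneg hm]

/-- The Jacobi triple product identity. -/
theorem thetaSeries_eq_qp {p z : ℂ} (hp : p ≠ 0) (hp1 : ‖p‖ < 1) (hz : z ≠ 0) :
    thetaSeries p z = qp p p * (qp (-z) p * qp (-(p / z)) p) := by
  have hE := qp_ne_zero hp1 hp1
  have hfin : Tendsto (fun n : ℕ ↦ ∏ i ∈ Finset.range (2 * n), (1 - p ^ (i + 1))) atTop
      (𝓝 (qp p p)) := by
    have h := (tendsto_qp p hp1).comp (tendsto_id.const_mul_atTop' two_pos)
    simpa only [Function.comp_def, id, pow_succ'] using h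
  have hcoeff (j : ℤ) : Tendsto (fun n ↦ tripleCoeff p n j) atTop (𝓝 (qp p p)⁻¹) := by
    have hn := tendsto_natCast_atTop_atTop (R := ℤ)
    have hE' (k : ℤ) := (tendsto_eulerInv_int hp1).comp (tendsto_atTop_add_const_right _ k hn)
    have h := (hfin.mul (hE' j)).mul (hE' (-j))
    rwa [mul_inv_cancel₀ hE, one_mul] at h
  obtain ⟨C, hC⟩ := exists_norm_eulerInv_le hp1
  obtain ⟨D, hD⟩ := (Metric.isBounded_range_of_tendsto _ hfin).exists_norm_le
  have hbound (n : ℕ) (j : ℤ) : ‖tripleCoeff p n j‖ ≤ D * C * C := by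
    have hC0 := (norm_nonneg _).trans (hC 0)
    have hD0 := (norm_nonneg _).trans (hD _ ⟨0, rfl⟩)
    rw [tripleCoeff, norm_mul, norm_mul]
    gcongr
    exacts [hD _ ⟨n, rfl⟩, hC _, hC _]
  have hlim := tendsto_tsum_of_dominated_convergence (𝓕 := atTop)
    (f := fun n j ↦ tripleCoeff p n j * thetaTerm p z j)
    ((summable_thetaTerm hp hp1 hz).mul_left (D * C * C))
    (fun j ↦ (hcoeff j).mul_const (thetaTerm p z j))
    (Eventually.of_forall fun n j ↦ by
      rw [norm_mul]
      exact mul_le_mul_of_nonneg_right (hbound n j) (norm_nonneg _))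
  simp only [(hasSum_tripleCoeff hp hp1 hz _).tsum_eq, tsum_mul_left] at hlim
  have hprod := (tendsto_qp (-z) hp1).mul (tendsto_qp (-(p / z)) hp1)
  simp only [neg_mul, sub_neg_eq_add] at hprod
  rw [tendsto_nhds_unique hprod hlim, thetaSeries, mul_inv_cancel_left₀ hE]

lemma norm_pow_lt_one {q : ℂ} (hq1 : ‖q‖ < 1) {n : ℕ} (hn : n ≠ 0) : ‖q ^ n‖ < 1 := by
  rw [norm_pow]
  exact pow_lt_one₀ (norm_nonneg _) hq1 hn

lemma qp_pow_ne_zero {q : ℂ} (hq1 : ‖q‖ < 1) {m n : ℕ} (hm : m ≠ 0) (hn : n ≠ 0) :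
    qp (q ^ m) (q ^ n) ≠ 0 :=
  qp_ne_zero (norm_pow_lt_one hq1 hm) (norm_pow_lt_one hq1 hn)

lemma R_ne_zero {q : ℂ} (hq1 : ‖q‖ < 1) : R q ≠ 0 := by
  have h1 := qp_ne_zero hq1 (norm_pow_lt_one hq1 (n := 5) (by norm_num))
  have (m : ℕ) (hm : m ≠ 0) := qp_pow_ne_zero hq1 hm (n := 5) (by norm_num)
  exact div_ne_zero (mul_ne_zero h1 (this 4 (by norm_num)))
    (mul_ne_zero (this 2 (by norm_num)) (this 3 (by norm_num)))

lemma analyticAt_qp_pow {q : ℂ} (hq1 : ‖q‖ < 1) (m : ℕ) {n : ℕ} (hn : n ≠ 0) :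
    AnalyticAt ℂ (fun x ↦ qp (x ^ m) (x ^ n)) q := by
  obtain ⟨r, hqr, hr⟩ := exists_between hq1
  have hr0 : 0 ≤ r := (norm_nonneg q).trans hqr.le
  have h := Summable.hasProdLocallyUniformlyOn_nat_one_add (K := Metric.ball (0 : ℂ) r)
    (f := fun k x ↦ -(x ^ m * (x ^ n) ^ k)) Metric.isOpen_ball
    (summable_geometric_of_lt_one hr0 hr)
    (Eventually.of_forall fun k x hx ↦ by
      have hx' : ‖x‖ ≤ r := by simpa using (mem_ball_zero_iff.1 hx).le
      rw [norm_neg, ← pow_mul, ← pow_add, norm_pow]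
      calc ‖x‖ ^ (m + n * k) ≤ r ^ (m + n * k) := by gcongr
        _ ≤ r ^ k := pow_le_pow_of_le_one hr0 hr.le (by nlinarith [Nat.pos_of_ne_zero hn]))
    (fun k ↦ by fun_prop)
  simp only [← sub_eq_add_neg] at h
  have hd := (hasProdLocallyUniformlyOn_iff_tendstoLocallyUniformlyOn.1 h).differentiableOn
    (.of_forall fun _ ↦ DifferentiableOn.fun_finsetProd fun _ _ ↦ by fun_prop) Metric.isOpen_ball
  exact hd.analyticAt (Metric.isOpen_ball.mem_nhds (by simpa using hqr))

lemma analyticAt_R {q : ℂ} (hq1 : ‖q‖ < 1) : AnalyticAt ℂ R q := by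
  have h (m : ℕ) := analyticAt_qp_pow hq1 m (n := 5) (by norm_num)
  have hne (m : ℕ) (hm : m ≠ 0) := qp_pow_ne_zero hq1 hm (n := 5) (by norm_num)
  have h1 := h 1
  simp only [pow_one] at h1
  exact (h1.mul (h 4)).div ((h 2).mul (h 3))
    (mul_ne_zero (hne 2 (by norm_num)) (hne 3 (by norm_num)))

lemma analyticAt_R_pow {q : ℂ} (hq1 : ‖q‖ < 1) {n : ℕ} (hn : n ≠ 0) :
    AnalyticAt ℂ (fun x ↦ R (x ^ n)) q :=
  (analyticAt_R (norm_pow_lt_one hq1 hn)).comp (f := fun x ↦ x ^ n) (analyticAt_id.pow n)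

lemma theta_quotient_relation {q a b a' b' A B X Y E F : ℂ} (hE : E ≠ 0) (hb : b ≠ 0)
    (hB : B ≠ 0)
    (hadd : E ^ 2 * (a' * b) = F ^ 2 * (Y * B + q * A * X))
    (hsub : E ^ 2 * (a * b') = F ^ 2 * (Y * B - q * A * X))
    (ha' : a * a' = A) (hb' : b * b' = B) (haX : a = X * B) (hbY : b = Y * A) :
    A / B - (a / b) ^ 2 = q * (a / b) * (A / B) ^ 2 * (A / B + (a / b) ^ 2) := by
  have h1 : (a' * b - a * b') * (Y * B) = q * A * X * (a' * b + a * b') := by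
    apply mul_left_cancel₀ (pow_ne_zero 2 hE)
    linear_combination (Y * B - q * A * X) * hadd - (Y * B + q * A * X) * hsub
  have h2 : (A * b ^ 2 - B * a ^ 2) * (Y * B) = q * A * X * (A * b ^ 2 + B * a ^ 2) := by
    rw [← ha', ← hb'] at *
    linear_combination a * b * h1
  have h3 : (A * b ^ 2 - B * a ^ 2) * (b * B ^ 2) = q * A ^ 2 * a * (A * b ^ 2 + B * a ^ 2) := by
    linear_combination A * B * h2 + (A * b ^ 2 - B * a ^ 2) * B ^ 2 * hbY -
      q * A ^ 2 * (A * b ^ 2 + B * a ^ 2) * haX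
  field_simp
  linear_combination h3

/-- The modular relation between `R(q)` and `R(q^2)`. -/
theorem R_sq_sub {q : ℂ} (hq : q ≠ 0) (hq1 : ‖q‖ < 1) :
    R (q ^ 2) - R q ^ 2 = q * R q * R (q ^ 2) ^ 2 * (R (q ^ 2) + R q ^ 2) := by
  have hp : q ^ 5 ≠ 0 := pow_ne_zero _ hq
  have hp1 : ‖q ^ 5‖ < 1 := norm_pow_lt_one hq1 (by norm_num)
  have hP : q ^ 10 ≠ 0 := pow_ne_zero _ hq
  have hP1 : ‖q ^ 10‖ < 1 := norm_pow_lt_one hq1 (by norm_num)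
  have jtp5 (z w : ℂ) (hz : z ≠ 0) (h : z * w = q ^ 5) :
      thetaSeries (q ^ 5) (-z) = qp (q ^ 5) (q ^ 5) * (qp z (q ^ 5) * qp w (q ^ 5)) := by
    rw [thetaSeries_eq_qp hp hp1 (neg_ne_zero.2 hz), ← h, div_neg, mul_div_cancel_left₀ _ hz,
      neg_neg, neg_neg]
  have jtp10 (z w : ℂ) (hz : z ≠ 0) (h : z * w = q ^ 10) :
      thetaSeries (q ^ 10) (-z) = qp (q ^ 10) (q ^ 10) * (qp z (q ^ 10) * qp w (q ^ 10)) := by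
    rw [thetaSeries_eq_qp hP hP1 (neg_ne_zero.2 hz), ← h, div_neg, mul_div_cancel_left₀ _ hz,
      neg_neg, neg_neg]
  have m1 := thetaSeries_mul hp hp1 hq (neg_ne_zero.2 (pow_ne_zero 2 hq))
  have m2 := thetaSeries_mul hp hp1 (neg_ne_zero.2 hq) (pow_ne_zero 2 hq)
  rw [← pow_mul, show 5 * 2 = 10 by norm_num,
    show q * -q ^ 2 = -q ^ 3 by ring, show q ^ 5 * q / -q ^ 2 = -q ^ 4 by field_simp,
    show q ^ 5 * q * -q ^ 2 = -q ^ 8 by ring, show q ^ 10 * q / -q ^ 2 = -q ^ 9 by field_simp,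
    jtp10 (q ^ 3) (q ^ 7) (by positivity) (by ring),
    jtp10 (q ^ 4) (q ^ 6) (by positivity) (by ring),
    jtp10 (q ^ 8) (q ^ 2) (by positivity) (by ring),
    jtp10 (q ^ 9) q (by positivity) (by ring),
    jtp5 (q ^ 2) (q ^ 3) (by positivity) (by ring)] at m1
  rw [← pow_mul, show 5 * 2 = 10 by norm_num,
    show -q * q ^ 2 = -q ^ 3 by ring, show q ^ 5 * -q / q ^ 2 = -q ^ 4 by field_simp,
    show q ^ 5 * -q * q ^ 2 = -q ^ 8 by ring, show q ^ 10 * -q / q ^ 2 = -q ^ 9 by field_simp,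
    jtp10 (q ^ 3) (q ^ 7) (by positivity) (by ring),
    jtp10 (q ^ 4) (q ^ 6) (by positivity) (by ring),
    jtp10 (q ^ 8) (q ^ 2) (by positivity) (by ring),
    jtp10 (q ^ 9) q (by positivity) (by ring),
    jtp5 q (q ^ 4) hq (by ring)] at m2
  have t1 := jtp5 (-q) (-q ^ 4) (neg_ne_zero.2 hq) (by ring)
  have t2 := jtp5 (-q ^ 2) (-q ^ 3) (neg_ne_zero.2 (pow_ne_zero 2 hq)) (by ring)
  rw [neg_neg] at t1 t2
  rw [t1] at m1
  rw [t2] at m2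
  have d1 := qp_mul_qp_neg q hp1
  have d2 := qp_mul_qp_neg (q ^ 2) hp1
  have d3 := qp_mul_qp_neg (q ^ 3) hp1
  have d4 := qp_mul_qp_neg (q ^ 4) hp1
  have s1 := qp_eq_mul_qp_sq q hp1
  have s2 := qp_eq_mul_qp_sq (q ^ 2) hp1
  have s3 := qp_eq_mul_qp_sq (q ^ 3) hp1
  have s4 := qp_eq_mul_qp_sq (q ^ 4) hp1
  simp only [← pow_mul, ← pow_succ', ← pow_add, Nat.reduceMul, Nat.reduceAdd]
    at d1 d2 d3 d4 s1 s2 s3 s4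
  have hne (m : ℕ) (hm : m ≠ 0) := qp_pow_ne_zero hq1 hm (n := 5) (by norm_num)
  have hNe (m : ℕ) (hm : m ≠ 0) := qp_pow_ne_zero hq1 hm (n := 10) (by norm_num)
  simp only [R, ← pow_mul, Nat.reduceMul]
  exact theta_quotient_relation (qp_ne_zero hp1 hp1)
    (mul_ne_zero (hne 2 (by norm_num)) (hne 3 (by norm_num)))
    (mul_ne_zero (hNe 4 (by norm_num)) (hNe 6 (by norm_num)))
    (a' := qp (-q) (q ^ 5) * qp (-q ^ 4) (q ^ 5)) (b' := qp (-q ^ 2) (q ^ 5) * qp (-q ^ 3) (q ^ 5))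
    (F := qp (q ^ 10) (q ^ 10)) (X := qp q (q ^ 10) * qp (q ^ 9) (q ^ 10))
    (Y := qp (q ^ 3) (q ^ 10) * qp (q ^ 7) (q ^ 10))
    (by linear_combination m1) (by linear_combination m2)
    (by rw [mul_mul_mul_comm, d1, d4]) (by rw [mul_mul_mul_comm, d2, d3])
    (by rw [s1, s4]; ring) (by rw [s2, s3]; ring)

/-- The three-level relation between `R(q)`, `R(q^2)` and `R(q^4)`. -/
theorem R_three_term {q : ℂ} (hq1 : ‖q‖ < 1) :
    (R (q ^ 2) + R q ^ 2) * (R q * R (q ^ 2) + q * R (q ^ 4) ^ 2) = 2 * R q * R (q ^ 4) := by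
  have han : AnalyticOnNhd ℂ (fun x ↦ (R (x ^ 2) + R x ^ 2) *
      (R x * R (x ^ 2) + x * R (x ^ 4) ^ 2) - 2 * R x * R (x ^ 4)) (Metric.ball 0 1) := by
    intro x hx
    have hx1 : ‖x‖ < 1 := by simpa using hx
    have h1 := analyticAt_R hx1
    have h2 := analyticAt_R_pow hx1 (n := 2) (by norm_num)
    have h4 := analyticAt_R_pow hx1 (n := 4) (by norm_num)
    fun_prop
  have hcont : ContinuousAt (fun x ↦ 1 + x * R x * R (x ^ 4)) 0 := by
    have h0 : ‖(0 : ℂ)‖ < 1 := by simp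
    have h1 := (analyticAt_R h0).continuousAt
    have h4 := (analyticAt_R_pow h0 (n := 4) (by norm_num)).continuousAt
    fun_prop
  have hev : ∀ᶠ x in 𝓝[≠] (0 : ℂ), (R (x ^ 2) + R x ^ 2) *
      (R x * R (x ^ 2) + x * R (x ^ 4) ^ 2) - 2 * R x * R (x ^ 4) = 0 := by
    filter_upwards [self_mem_nhdsWithin, nhdsWithin_le_nhds (Metric.ball_mem_nhds 0 one_pos),
      nhdsWithin_le_nhds (hcont.eventually_ne (by simp : 1 + 0 * R 0 * R (0 ^ 4) ≠ 0))]
      with x hx hx1 hne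
    replace hx1 : ‖x‖ < 1 := by simpa using hx1
    have hP := R_sq_sub hx hx1
    have hx2 := norm_pow_lt_one hx1 (n := 2) (by norm_num)
    have hQ := R_sq_sub (pow_ne_zero 2 hx) hx2
    rw [← pow_mul] at hQ
    have hv := R_ne_zero hx2
    refine (mul_eq_zero.1 ?_).resolve_left (mul_ne_zero hv hne)
    linear_combination (-(R x * (R (x ^ 2) + R x ^ 2))) * hQ +
      (x * R (x ^ 4) ^ 2 * R (x ^ 2) - R x * R (x ^ 4)) * hP
  exact sub_eq_zero.1 (han.eqOn_zero_of_preconnected_of_frequently_eq_zero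
    (convex_ball 0 1).isPreconnected (Metric.mem_ball_self one_pos) hev.frequently
    (by simpa using hq1))

theorem stmt_9 : ∀ q : ℂ, ‖q‖ < 1 →
    (1 / (R q * R (q ^ 4)) + q ^ 2 * R q * R (q ^ 4))
      - (R q / (R (q ^ 2) * R (q ^ 4)) - q ^ 2 * R (q ^ 2) * R (q ^ 4) / R q) = 2 * q := by
  intro q hq1
  have hu := R_ne_zero hq1
  have hv := R_ne_zero (norm_pow_lt_one hq1 (n := 2) (by norm_num))
  have hw := R_ne_zero (norm_pow_lt_one hq1 (n := 4) (by norm_num))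
  have hP : R (q ^ 2) - R q ^ 2 = q * R q * R (q ^ 2) ^ 2 * (R (q ^ 2) + R q ^ 2) := by
    rcases eq_or_ne q 0 with rfl | hq
    · simp [R, qp]
    · exact R_sq_sub hq hq1
  have hT := R_three_term hq1
  field_simp
  linear_combination hP + q * R (q ^ 2) * hT
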